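/- For each fixed x > 0, the functions C_j(x,λ) := x^{μ_j} Σ_{k=0}^{∞} c_{jk} λ^k x^{nk} (j = 1,…,n) are entire in λ, each solves equation (10): y^{(n)} + Σ_{m=0}^{n−2} ν_m x^{m−n} y^{(m)} = λ y on (0,∞), and, with the normalization ∏_{j=1}^{n} c_{j0} = (det[μ_j^{ν−1}]_{j,ν=1,…,n})^{−1}, their Wronskian satisfies det[C_j^{(ν−1)}(x,λ)]_{j,ν=1,…,n} = 1 for all x > 0 and all λ ∈ ℂ. -/

import Mathlib

open Filter Topology

def EntSeq (a : ℕ → ℂ) : Prop := ∀ R : ℝ, 0 ≤ R → Summable fun k => ‖a k‖ * R ^ k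

lemma EntSeq.natMul {a : ℕ → ℂ} (h : EntSeq a) : EntSeq fun k => (k : ℂ) * a k := by
  intro R hR
  refine Summable.of_nonneg_of_le (fun k => by positivity) (fun k => ?_) (h (2 * R) (by positivity))
  have : (k : ℝ) ≤ 2 ^ k := by exact_mod_cast (Nat.lt_two_pow_self (n := k)).le
  rw [norm_mul, mul_pow, Complex.norm_natCast]
  calc (k : ℝ) * ‖a k‖ * R ^ k = (k : ℝ) * (‖a k‖ * R ^ k) := by ring
    _ ≤ 2 ^ k * (‖a k‖ * R ^ k) := by gcongr
    _ = _ := by ring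

lemma EntSeq.constMul {a : ℕ → ℂ} (h : EntSeq a) (c : ℂ) : EntSeq fun k => c * a k := by
  intro R hR
  simpa [mul_assoc] using (h R hR).mul_left ‖c‖

lemma EntSeq.add {a b : ℕ → ℂ} (h : EntSeq a) (h' : EntSeq b) : EntSeq fun k => a k + b k := by
  intro R hR
  refine Summable.of_nonneg_of_le (fun k => by positivity) (fun k => ?_) ((h R hR).add (h' R hR))
  rw [← add_mul]
  gcongr
  exact norm_add_le _ _

lemma EntSeq.summable {a : ℕ → ℂ} (h : EntSeq a) (z : ℂ) : Summable fun k => a k * z ^ k := by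
  refine Summable.of_norm ?_
  simpa using h ‖z‖ (norm_nonneg _)

lemma EntSeq.deriv {a : ℕ → ℂ} (h : EntSeq a) (z : ℂ) :
    ∃ D : ℂ, HasDerivAt (fun w => ∑' k, a k * w ^ k) D z ∧
      z * D = ∑' k : ℕ, (k : ℂ) * a k * z ^ k := by
  set R := ‖z‖ + 1
  have hR : 1 ≤ R := by simp [R]
  refine ⟨∑' k : ℕ, a k * ((k : ℂ) * z ^ (k - 1)), ?_, ?_⟩
  · refine hasDerivAt_tsum_of_isPreconnected (t := Metric.ball 0 R) (y₀ := z)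
      (g' := fun k w => a k * ((k : ℂ) * w ^ (k - 1)))
      (h.natMul R (by linarith)) Metric.isOpen_ball (convex_ball _ _).isPreconnected ?_ ?_ ?_
      (h.summable z) ?_
    · intro k y _
      exact (hasDerivAt_pow k y).const_mul _
    · intro k y hy
      have hy : ‖y‖ ≤ R := by simpa using (Metric.mem_ball.1 hy).le
      simp only [norm_mul, norm_pow, Complex.norm_natCast]
      calc ‖a k‖ * (k * ‖y‖ ^ (k - 1)) ≤ ‖a k‖ * (k * R ^ (k - 1)) := by gcongr
        _ ≤ ‖a k‖ * (k * R ^ k) := by gcongr; omega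
        _ = _ := by ring
    · simp [R]
    · simp [R]
  · rw [← tsum_mul_left]
    congr 1; ext k
    rcases k with _ | k
    · simp
    · simp [pow_succ]; ring

lemma det_hasDerivAt {n : ℕ} (M : ℕ → Fin n → ℝ → ℂ) (x : ℝ)
    (hM : ∀ i j, HasDerivAt (M i j) (M (i+1) j x) x) :
    HasDerivAt (fun t => Matrix.det (Matrix.of fun j i : Fin n => M i j t))
      (∑ i : Fin n, Matrix.det ((Matrix.of fun j i : Fin n => M i j x).updateCol i
        fun j => M (i+1) j x)) x := by
  simp only [Matrix.det_apply]
  rw [Finset.sum_comm]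
  refine HasDerivAt.fun_sum fun σ _ => ?_
  rw [← Finset.smul_sum]
  refine HasDerivAt.const_smul _ ?_
  have := HasDerivAt.fun_finsetProd (u := Finset.univ) (f := fun (i : Fin n) t => M i (σ i) t)
    (f' := fun i => M (i+1) (σ i) x) (x := x) (fun i _ => hM _ _)
  simp only [Matrix.of_apply]
  refine this.congr_deriv ?_
  refine Finset.sum_congr rfl fun i _ => ?_
  rw [← Finset.prod_erase_mul Finset.univ _ (Finset.mem_univ i)]
  simp only [smul_eq_mul, Matrix.updateCol_self]
  congr 1
  refine Finset.prod_congr rfl fun k hk => ?_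
  rw [Matrix.updateCol_ne (Finset.ne_of_mem_erase hk)]
  rfl

/-- Wronskian derivative vanishes -/
lemma wronsk_deriv_zero {n : ℕ} (hn : 2 ≤ n) (M : ℕ → Fin n → ℝ → ℂ) (x : ℝ)
    (hM : ∀ i j, HasDerivAt (M i j) (M (i+1) j x) x) (d : Fin n → ℂ)
    (hd : d ⟨n - 1, by omega⟩ = 0) (hlin : ∀ j, M n j x = ∑ i : Fin n, d i * M i j x) :
    HasDerivAt (fun t => Matrix.det (Matrix.of fun j i : Fin n => M i j t)) 0 x := by
  convert det_hasDerivAt M x hM using 1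
  symm
  refine Finset.sum_eq_zero fun i _ => ?_
  by_cases hi : (i : ℕ) + 1 < n
  · exact Matrix.det_updateCol_eq_zero (M := Matrix.of fun j i : Fin n => M i j x)
      (i := ⟨i + 1, hi⟩) (j := i) (by simp [Fin.ext_iff])
  · have hi' : i = ⟨n - 1, by omega⟩ := by ext; simp; omega
    have h1 : (i : ℕ) + 1 = n := by omega
    have := Matrix.det_updateCol_sum (Matrix.of fun j i : Fin n => M i j x) i d
    rw [hi'] at this ⊢
    rw [hd, zero_smul] at this
    rw [← this]
    congr 2
    ext j
    rw [show ((⟨n - 1, by omega⟩ : Fin n) : ℕ) + 1 = n by simp; omega, hlin]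
    simp

lemma sum_roots (n : ℕ) (hn : 2 ≤ n) (v : ℕ → ℂ) (hvn : v n = 1) (hvn1 : v (n - 1) = 0)
    (μ : Fin n → ℂ)
    (h : ∀ z, ∑ j ∈ Finset.range (n + 1), v j * (descPochhammer ℂ j).eval z = ∏ j, (z - μ j)) :
    ∑ j, μ j = ∑ i : Fin n, ((i : ℕ) : ℂ) := by
  have hD : ∀ j, descPochhammer ℂ j = ∏ i ∈ Finset.range j, (Polynomial.X - Polynomial.C (i : ℂ)) := by
    intro j
    refine Polynomial.funext fun z => ?_
    simp [descPochhammer_eval_eq_prod_range, Polynomial.eval_prod]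
  have hP : ∑ j ∈ Finset.range (n + 1), Polynomial.C (v j) * descPochhammer ℂ j
      = ∏ j, (Polynomial.X - Polynomial.C (μ j)) := by
    refine Polynomial.funext fun z => ?_
    simp [Polynomial.eval_prod, Polynomial.eval_finsetSum, h]
  have h1 := congrArg (fun p => Polynomial.coeff p (n - 1)) hP
  have h2 := Polynomial.prod_X_sub_C_coeff_card_pred (Finset.univ : Finset (Fin n)) μ (by simp; omega)
  have h3 := Polynomial.prod_X_sub_C_coeff_card_pred (Finset.range n) (fun i => (i : ℂ)) (by simp; omega)
  simp only [Finset.card_univ, Fintype.card_fin, Finset.card_range] at h2 h3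
  simp only [h2, Polynomial.finsetSum_coeff, Polynomial.coeff_C_mul] at h1
  rw [Finset.sum_range_succ, Finset.sum_eq_zero, hD, h3, hvn] at h1
  · rw [Fin.sum_univ_eq_sum_range (fun i => (i : ℂ))]
    linear_combination h1
  · intro j hj
    rw [Finset.mem_range] at hj
    by_cases hj' : j = n - 1
    · simp [hj', hvn1]
    · rw [Polynomial.coeff_eq_zero_of_natDegree_lt, mul_zero]
      rw [descPochhammer_natDegree]; omega

lemma entSeq_c (a : ℕ → ℂ) (p : ℕ → ℂ) (hp : Tendsto (fun k => ‖p k‖) atTop atTop)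
    (h : ∀ k, a (k+1) * p k = a k) : EntSeq a := by
  intro R hR
  refine summable_of_ratio_norm_eventually_le (r := 1/2) (by norm_num) ?_
  filter_upwards [hp.eventually_ge_atTop (2 * R + 1)] with k hk
  rw [← h k]
  simp only [norm_mul, norm_norm, norm_pow, Real.norm_of_nonneg hR]
  have : 0 ≤ ‖a (k+1)‖ * R ^ k := by positivity
  rw [pow_succ]
  nlinarith

noncomputable def ffa (n : ℕ) (μ : ℂ) (a : ℕ → ℂ) (m : ℕ) (k : ℕ) : ℂ :=
  a k * (descPochhammer ℂ m).eval (μ + (k : ℂ) * n)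

noncomputable def HH (n : ℕ) (μ : ℂ) (a : ℕ → ℂ) (m : ℕ) (z : ℂ) : ℂ :=
  ∑' k, ffa n μ a m k * z ^ k

lemma ffa_succ (n : ℕ) (μ : ℂ) (a : ℕ → ℂ) (m k : ℕ) :
    ffa n μ a (m+1) k = (μ - m) * ffa n μ a m k + n * (k * ffa n μ a m k) := by
  simp only [ffa, descPochhammer_succ_eval]; ring

lemma ffa_ent (n : ℕ) (μ : ℂ) {a : ℕ → ℂ} (h : EntSeq a) (m : ℕ) : EntSeq (ffa n μ a m) := by
  induction m with
  | zero => convert h using 1; ext k; simp [ffa]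
  | succ m ih =>
    have := (ih.constMul (μ - m)).add (ih.natMul.constMul n)
    convert this using 1
    ext k; exact ffa_succ ..

lemma HH_deriv (n : ℕ) (μ : ℂ) {a : ℕ → ℂ} (h : EntSeq a) (m : ℕ) (z : ℂ) :
    ∃ D : ℂ, HasDerivAt (HH n μ a m) D z ∧
      HH n μ a (m+1) z = (μ - m) * HH n μ a m z + n * (z * D) := by
  obtain ⟨D, h1, h2⟩ := (ffa_ent n μ h m).deriv z
  refine ⟨D, h1, ?_⟩
  rw [h2, HH, HH, ← tsum_mul_left, ← tsum_mul_left, ← Summable.tsum_add]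
  · congr 1; ext k; rw [ffa_succ]; ring
  · exact ((ffa_ent n μ h m).summable z).mul_left _
  · exact ((ffa_ent n μ h m).natMul.summable z).mul_left _

noncomputable def GG (n : ℕ) (μ : ℂ) (a : ℕ → ℂ) (lam : ℂ) (m : ℕ) (x : ℝ) : ℂ :=
  (x : ℂ) ^ (μ - m) * HH n μ a m (lam * (x : ℂ) ^ n)

lemma GG_deriv (n : ℕ) (hn : 2 ≤ n) (μ : ℂ) {a : ℕ → ℂ} (h : EntSeq a) (lam : ℂ) (m : ℕ) (x : ℝ)
    (hx : 0 < x) : HasDerivAt (GG n μ a lam m) (GG n μ a lam (m+1) x) x := by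
  obtain ⟨D, h1, h2⟩ := HH_deriv n μ h m (lam * (x : ℂ) ^ n)
  have hx0 : (x : ℂ) ≠ 0 := by exact_mod_cast hx.ne'
  have e1 : HasDerivAt (fun w : ℂ => w ^ (μ - m)) ((μ - m) * (x : ℂ) ^ (μ - m - 1)) (x : ℂ) := by
    simpa using (hasDerivAt_id (x : ℂ)).cpow_const (c := μ - m)
      (Complex.ofReal_mem_slitPlane.2 hx)
  have e2 : HasDerivAt (fun w : ℂ => lam * w ^ n) (lam * (n * (x : ℂ) ^ (n - 1))) (x : ℂ) :=
    (hasDerivAt_pow n _).const_mul _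
  have e3 := (e1.mul (h1.comp (x : ℂ) e2)).comp_ofReal
  refine e3.congr_deriv ?_
  simp only [GG, h2, Function.comp]
  obtain ⟨k, rfl⟩ : ∃ k, n = k + 1 := ⟨n - 1, by omega⟩
  have e4 : (x : ℂ) ^ (μ - m) = (x : ℂ) ^ (μ - m - 1) * x := by
    rw [Complex.cpow_sub (μ - m) 1 hx0, Complex.cpow_one]; field_simp
  have e5 : (x : ℂ) ^ (μ - ((m + 1 : ℕ) : ℂ)) = (x : ℂ) ^ (μ - m - 1) := by
    congr 1; push_cast; ring
  rw [e5, e4]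
  simp only [Nat.add_sub_cancel, pow_succ]
  ring

lemma GG_iter (n : ℕ) (hn : 2 ≤ n) (μ : ℂ) {a : ℕ → ℂ} (h : EntSeq a) (lam : ℂ) (f : ℝ → ℂ)
    (hf : ∀ x, 0 < x → f x = GG n μ a lam 0 x) (m : ℕ) :
    ∀ x, 0 < x → iteratedDeriv m f x = GG n μ a lam m x := by
  induction m with
  | zero => simpa using hf
  | succ m ih =>
    intro x hx
    rw [iteratedDeriv_succ]
    have : iteratedDeriv m f =ᶠ[𝓝 x] GG n μ a lam m := by
      filter_upwards [lt_mem_nhds hx] with y hy using ih y hy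
    rw [this.deriv_eq, (GG_deriv n hn μ h lam m x hx).deriv]

lemma HH_ode (n : ℕ) (v : ℕ → ℂ) (Δ : ℂ → ℂ)
    (hΔ : ∀ z, Δ z = ∑ j ∈ Finset.range (n + 1), v j * (descPochhammer ℂ j).eval z)
    (μ : ℂ) {a : ℕ → ℂ} (h : EntSeq a) (h0 : Δ μ = 0)
    (hr : ∀ k : ℕ, a (k+1) * Δ (μ + ((k + 1 : ℕ) : ℂ) * n) = a k) (z : ℂ) :
    ∑ m ∈ Finset.range (n+1), v m * HH n μ a m z = z * HH n μ a 0 z := by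
  have e : ∀ m, v m * HH n μ a m z = ∑' k, v m * (ffa n μ a m k * z ^ k) := fun m => by
    rw [HH, tsum_mul_left]
  have hs : ∀ m, Summable fun k => v m * (ffa n μ a m k * z ^ k) := fun m =>
    ((ffa_ent n μ h m).summable z).mul_left _
  have e2 : ∀ k, ∑ m ∈ Finset.range (n+1), v m * (ffa n μ a m k * z ^ k)
      = a k * Δ (μ + (k : ℂ) * n) * z ^ k := by
    intro k
    rw [hΔ, Finset.mul_sum, Finset.sum_mul]
    refine Finset.sum_congr rfl fun m _ => ?_
    simp only [ffa]; ring
  simp only [e]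
  rw [← Summable.tsum_finsetSum (fun m _ => hs m)]
  have hsum := summable_sum (s := Finset.range (n+1)) (fun m _ => hs m)
  simp only [e2] at hsum ⊢
  rw [hsum.tsum_eq_zero_add, HH, ← tsum_mul_left]
  simp only [Nat.cast_zero, zero_mul, add_zero, h0, mul_zero, zero_add]
  congr 1; ext k
  rw [hr]; simp [ffa, pow_succ]; ring

lemma GG_ode (n : ℕ) (hn : 2 ≤ n) (v : ℕ → ℂ) (hvn : v n = 1) (hvn1 : v (n - 1) = 0) (Δ : ℂ → ℂ)
    (hΔ : ∀ z, Δ z = ∑ j ∈ Finset.range (n + 1), v j * (descPochhammer ℂ j).eval z)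
    (μ : ℂ) {a : ℕ → ℂ} (h : EntSeq a) (h0 : Δ μ = 0)
    (hr : ∀ k : ℕ, a (k+1) * Δ (μ + ((k + 1 : ℕ) : ℂ) * n) = a k) (lam : ℂ) (x : ℝ) (hx : 0 < x) :
    GG n μ a lam n x + ∑ m ∈ Finset.range (n - 1),
      v m * (x : ℂ) ^ ((m : ℂ) - (n : ℂ)) * GG n μ a lam m x = lam * GG n μ a lam 0 x := by
  have hx0 : (x : ℂ) ≠ 0 := by exact_mod_cast hx.ne'
  have key := HH_ode n v Δ hΔ μ h h0 hr (lam * (x : ℂ) ^ n)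
  have e : ∀ m : ℕ, v m * (x : ℂ) ^ ((m : ℂ) - (n : ℂ)) * GG n μ a lam m x
      = (x : ℂ) ^ (μ - n) * (v m * HH n μ a m (lam * (x : ℂ) ^ n)) := by
    intro m
    have : (x : ℂ) ^ (μ - n) = (x : ℂ) ^ ((m : ℂ) - (n : ℂ)) * (x : ℂ) ^ (μ - m) := by
      rw [← Complex.cpow_add _ _ hx0]; congr 1; ring
    rw [this, GG]; ring
  simp only [e]
  rw [← Finset.mul_sum]
  obtain ⟨k, rfl⟩ : ∃ k, n = k + 1 := ⟨n - 1, by omega⟩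
  rw [Finset.sum_range_succ, Finset.sum_range_succ, hvn] at key
  simp only [Nat.add_sub_cancel] at hvn1 ⊢
  rw [hvn1] at key
  have e3 : (x : ℂ) ^ (μ - ((0:ℕ):ℂ)) = (x : ℂ) ^ (μ - ((k + 1 : ℕ) : ℂ)) * (x : ℂ) ^ (k + 1) := by
    rw [← Complex.cpow_natCast, ← Complex.cpow_add _ _ hx0]; congr 1; push_cast; ring
  simp only [GG]
  rw [e3]
  linear_combination (x : ℂ) ^ (μ - ((k + 1 : ℕ) : ℂ)) * key

lemma HH_zero (n : ℕ) (μ : ℂ) (a : ℕ → ℂ) (m : ℕ) :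
    HH n μ a m 0 = a 0 * (descPochhammer ℂ m).eval μ := by
  rw [HH, tsum_eq_single 0]
  · simp [ffa]
  · intro k hk; simp [hk]

lemma W_eq (n : ℕ) (μ : Fin n → ℂ) (c : Fin n → ℕ → ℂ) (hsum : ∑ j, μ j = ∑ i : Fin n, ((i : ℕ) : ℂ))
    (lam : ℂ) (x : ℝ) (hx : 0 < x) :
    Matrix.det (Matrix.of fun j i : Fin n => GG n (μ j) (c j) lam i x) =
    Matrix.det (Matrix.of fun j i : Fin n => HH n (μ j) (c j) i (lam * (x : ℂ) ^ n)) := by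
  have hx0 : (x : ℂ) ≠ 0 := by exact_mod_cast hx.ne'
  have h1 := Matrix.det_mul_column (fun j => (x : ℂ) ^ (μ j))
    (Matrix.of fun j i : Fin n => (x : ℂ) ^ (-((i : ℕ) : ℂ)) * (Matrix.of fun j i : Fin n => HH n (μ j) (c j) i (lam * (x : ℂ) ^ n)) j i)
  rw [Matrix.det_mul_row] at h1
  have hp : ∀ f : Fin n → ℂ, ∏ j, (x : ℂ) ^ (f j) = (x : ℂ) ^ (∑ j, f j) := by
    intro f
    simp only [Complex.cpow_def_of_ne_zero hx0, ← Complex.exp_sum, Finset.mul_sum]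
  rw [hp, hp, ← mul_assoc, ← Complex.cpow_add _ _ hx0, hsum, Finset.sum_neg_distrib, add_neg_cancel,
    Complex.cpow_zero, one_mul] at h1
  rw [← h1]
  congr 1
  ext j i
  simp only [Matrix.of_apply, GG]
  rw [sub_eq_add_neg, Complex.cpow_add _ _ hx0, mul_assoc]

lemma W_zero (n : ℕ) (μ : Fin n → ℂ) (hμ : Function.Injective μ) (c : Fin n → ℕ → ℂ)
    (hnorm : ∏ j, c j 0 = (Matrix.det (Matrix.of fun j i : Fin n => μ j ^ (i : ℕ)))⁻¹) :
    Matrix.det (Matrix.of fun j i : Fin n => HH n (μ j) (c j) i 0) = 1 := by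
  simp only [HH_zero]
  have h1 := Matrix.det_mul_column (fun j => c j 0)
    (Matrix.of fun j i : Fin n => (descPochhammer ℂ i).eval (μ j))
  have h2 := Matrix.det_eval_matrixOfPolynomials_eq_det_vandermonde μ
    (fun i : Fin n => descPochhammer ℂ i) (fun i => by simp) (fun i => monic_descPochhammer _ _)
  simp only [Matrix.of_apply] at h1
  rw [h1, ← h2, hnorm]
  exact inv_mul_cancel₀ (Matrix.det_vandermonde_ne_zero_iff.2 hμ)

lemma W_one (n : ℕ) (hn : 2 ≤ n) (μ : Fin n → ℂ) (hμ : Function.Injective μ) (c : Fin n → ℕ → ℂ)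
    (hE : ∀ j, EntSeq (c j))
    (hnorm : ∏ j, c j 0 = (Matrix.det (Matrix.of fun j i : Fin n => μ j ^ (i : ℕ)))⁻¹)
    (hsum : ∑ j, μ j = ∑ i : Fin n, ((i : ℕ) : ℂ)) (v : ℕ → ℂ) (lam : ℂ)
    (hode : ∀ j, ∀ x : ℝ, 0 < x → GG n (μ j) (c j) lam n x + ∑ m ∈ Finset.range (n - 1),
      v m * (x : ℂ) ^ ((m : ℂ) - (n : ℂ)) * GG n (μ j) (c j) lam m x = lam * GG n (μ j) (c j) lam 0 x)
    (x : ℝ) (hx : 0 < x) :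
    Matrix.det (Matrix.of fun j i : Fin n => GG n (μ j) (c j) lam i x) = 1 := by
  set W : ℝ → ℂ := fun x => Matrix.det (Matrix.of fun j i : Fin n => GG n (μ j) (c j) lam i x) with hW
  have hd : ∀ x, 0 < x → HasDerivAt W 0 x := by
    intro x hx
    refine wronsk_deriv_zero hn (fun i j t => GG n (μ j) (c j) lam i t) x
      (fun i j => GG_deriv n hn (μ j) (hE j) lam i x hx)
      (fun i => (if (i : ℕ) = 0 then lam else 0) -
        (if (i : ℕ) < n - 1 then v i * (x : ℂ) ^ (((i : ℕ) : ℂ) - (n : ℂ)) else 0)) ?_ ?_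
    · have : n - 1 ≠ 0 := by omega
      simp [this]
    · intro j
      rw [Fin.sum_univ_eq_sum_range (fun i : ℕ => ((if i = 0 then lam else 0) -
        (if i < n - 1 then v i * (x : ℂ) ^ ((i : ℂ) - (n : ℂ)) else 0)) * GG n (μ j) (c j) lam i x)]
      simp only [sub_mul, Finset.sum_sub_distrib, ite_mul, zero_mul]
      rw [Finset.sum_ite_eq' , if_pos (by simp; omega), ← Finset.sum_filter]
      have : (Finset.range n).filter (fun i => i < n - 1) = Finset.range (n - 1) := by
        ext i; simp; omega
      rw [this, ← hode j x hx]; ring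
  have hconst : ∀ y, 0 < y → W y = W x := fun y hy =>
    isOpen_Ioi.is_const_of_deriv_eq_zero (convex_Ioi (0:ℝ)).isPreconnected
      (fun t ht => (hd t ht).differentiableAt.differentiableWithinAt)
      (fun t ht => (hd t ht).deriv) hy hx
  have hcont : Continuous fun y : ℝ =>
      Matrix.det (Matrix.of fun j i : Fin n => HH n (μ j) (c j) i (lam * (y : ℂ) ^ n)) := by
    refine Continuous.matrix_det ?_
    refine continuous_matrix fun j i => ?_
    have : Continuous (HH n (μ j) (c j) i) := continuous_iff_continuousAt.2 fun z => by
      obtain ⟨D, h1, _⟩ := HH_deriv n (μ j) (hE j) i z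
      exact h1.continuousAt
    exact this.comp (by fun_prop)
  have ht := (hcont.tendsto 0).mono_left (nhdsWithin_le_nhds (s := Set.Ioi 0))
  have hn0 : n ≠ 0 := by omega
  simp only [Complex.ofReal_zero, zero_pow hn0, mul_zero, W_zero n μ hμ c hnorm] at ht
  refine tendsto_nhds_unique ?_ ht
  refine tendsto_const_nhds.congr' ?_
  filter_upwards [self_mem_nhdsWithin] with y hy
  rw [← W_eq n μ c hsum lam y hy]
  exact (hconst y hy).symm


/-- For fixed x > 0 the functions C_j(x,λ) = x^{μ_j} Σ_k c_{jk} λ^k x^{nk}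
are entire in λ, each solves equation (10) on (0,∞), and with the normalization
∏_j c_{j0} = (det[μ_j^{ν−1}])⁻¹ their Wronskian is identically 1. -/
theorem stmt15 (n : ℕ) (hn : 2 ≤ n) (v : ℕ → ℂ) (hvn : v n = 1) (hvn1 : v (n - 1) = 0)
    (Δ : ℂ → ℂ)
    (hΔ : ∀ z, Δ z = ∑ j ∈ Finset.range (n + 1), v j * ∏ k ∈ Finset.range j, (z - (k : ℂ)))
    (μ : Fin n → ℂ)
    (hroots : ∀ z, Δ z = ∏ j, (z - μ j))
    (hsep : ∀ j k, j ≠ k → ∀ s : ℤ, μ j - μ k ≠ (s : ℂ) * (n : ℂ))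
    (hre : StrictMono fun j => (μ j).re)
    (c0 : Fin n → ℂ) (hc0 : ∀ j, c0 j ≠ 0)
    (hnorm : ∏ j, c0 j = (Matrix.det (Matrix.of fun j i : Fin n => μ j ^ (i : ℕ)))⁻¹)
    (c : Fin n → ℕ → ℂ)
    (hc : ∀ j k, c j k = c0 j * (∏ s ∈ Finset.Icc 1 k, Δ (μ j + (s : ℂ) * (n : ℂ)))⁻¹)
    (C : Fin n → ℝ → ℂ → ℂ)
    (hC : ∀ j x lam, C j x lam
      = (x : ℂ) ^ (μ j) * ∑' k : ℕ, c j k * lam ^ k * (x : ℂ) ^ (n * k)) :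
    -- entire in λ for each fixed x > 0
    (∀ j : Fin n, ∀ x : ℝ, 0 < x → Differentiable ℂ (fun lam : ℂ => C j x lam)) ∧
    -- each C_j(·,λ) solves equation (10) on (0,∞)
    (∀ j : Fin n, ∀ lam : ℂ, ∀ x : ℝ, 0 < x →
      iteratedDeriv n (fun t => C j t lam) x
        + ∑ m ∈ Finset.range (n - 1),
            v m * (x : ℂ) ^ ((m : ℂ) - (n : ℂ)) * iteratedDeriv m (fun t => C j t lam) x
      = lam * C j x lam) ∧
    -- Wronskian identically one
    (∀ lam : ℂ, ∀ x : ℝ, 0 < x →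
      Matrix.det (Matrix.of fun j i : Fin n =>
        iteratedDeriv (i : ℕ) (fun t => C j t lam) x) = 1) := by
  have hn0 : (n : ℂ) ≠ 0 := by exact_mod_cast (by omega : n ≠ 0)
  have hΔ' : ∀ z, Δ z = ∑ j ∈ Finset.range (n + 1), v j * (descPochhammer ℂ j).eval z := by
    intro z; rw [hΔ]; simp only [descPochhammer_eval_eq_prod_range]
  have hne : ∀ j (s : ℕ), 1 ≤ s → Δ (μ j + (s : ℂ) * n) ≠ 0 := by
    intro j s hs
    rw [hroots, Finset.prod_ne_zero_iff]
    intro k _ hk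
    by_cases hjk : k = j
    · subst hjk
      have : (s : ℂ) * n = 0 := by linear_combination hk
      rcases mul_eq_zero.1 this with h | h
      · have : s = 0 := by exact_mod_cast h
        omega
      · exact hn0 h
    · refine hsep k j hjk s ?_
      push_cast
      linear_combination -hk
  have hr : ∀ j (k : ℕ), c j (k+1) * Δ (μ j + ((k + 1 : ℕ) : ℂ) * n) = c j k := by
    intro j k
    rw [hc, hc, Finset.prod_Icc_succ_top (by omega), mul_inv, mul_assoc, mul_assoc,
      inv_mul_cancel₀ (hne j (k+1) (by omega)), mul_one]
  have hz : ∀ j, Δ (μ j) = 0 := fun j => by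
    rw [hroots]; exact Finset.prod_eq_zero (Finset.mem_univ j) (sub_self _)
  have hE : ∀ j, EntSeq (c j) := by
    intro j
    refine entSeq_c _ _ ?_ (hr j)
    have h1 := Polynomial.tendsto_norm_atTop (∏ i, (Polynomial.X - Polynomial.C (μ i)))
      (l := atTop) (z := fun k : ℕ => μ j + ((k + 1 : ℕ) : ℂ) * n) ?_ ?_
    · refine h1.congr fun k => ?_
      rw [hroots]; simp [Polynomial.eval_prod]
    · rw [Polynomial.degree_prod]
      simp
      omega
    · have h2 : Tendsto (fun k : ℕ => (k : ℝ) - ‖μ j‖) atTop atTop :=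
        tendsto_atTop_add_const_right _ _ tendsto_natCast_atTop_atTop
      refine tendsto_atTop_mono (fun k => ?_) h2
      have h3 : ‖((k + 1 : ℕ) : ℂ) * n‖ ≤ ‖μ j + ((k + 1 : ℕ) : ℂ) * n‖ + ‖μ j‖ := by
        have := norm_sub_le (μ j + ((k + 1 : ℕ) : ℂ) * n) (μ j)
        simpa using this
      have h4 : (k : ℝ) ≤ ‖((k + 1 : ℕ) : ℂ) * n‖ := by
        rw [← Nat.cast_mul, Complex.norm_natCast]
        exact_mod_cast (by nlinarith : k ≤ (k + 1) * n)
      linarith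
  have hCH : ∀ j (x : ℝ) lam, C j x lam = GG n (μ j) (c j) lam 0 x := by
    intro j x lam
    rw [hC, GG, HH]
    simp only [Nat.cast_zero, sub_zero]
    congr 2; ext k
    simp [ffa, mul_pow, pow_mul, mul_assoc]
  have hit : ∀ j lam (m : ℕ) x, 0 < x →
      iteratedDeriv m (fun t => C j t lam) x = GG n (μ j) (c j) lam m x := fun j lam m x hx =>
    GG_iter n hn (μ j) (hE j) lam _ (fun x _ => hCH j x lam) m x hx
  have hode := fun j lam x hx => GG_ode n hn v hvn hvn1 Δ hΔ' (μ j) (hE j) (hz j) (hr j) lam x hx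
  refine ⟨?_, ?_, ?_⟩
  · intro j x hx
    simp only [hCH, GG]
    refine Differentiable.const_mul ?_ _
    have : Differentiable ℂ (HH n (μ j) (c j) 0) := fun z => by
      obtain ⟨D, h1, _⟩ := HH_deriv n (μ j) (hE j) 0 z
      exact h1.differentiableAt
    exact this.comp (by fun_prop)
  · intro j lam x hx
    simp only [hit j lam _ x hx]
    rw [hCH]
    exact hode j lam x hx
  · intro lam x hx
    simp only [hit _ lam _ x hx]
    refine W_one n hn μ ?_ c hE ?_ (sum_roots n hn v hvn hvn1 μ fun z => ?_) v lam
      (fun j x hx => hode j lam x hx) x hx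
    · intro i j hij
      exact hre.injective (congrArg Complex.re hij)
    · rw [← hnorm]
      simp [hc]
    · rw [← hΔ', hroots]
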